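/- arXiv:1204.5802 — 5 statements merged into one kernel-verified Lean document; each statement's English description precedes it below -/
import Mathlib

section
/- (Projectors) Let A, B be proxets and let (f, g) be an adjunction, i.e. proximity morphisms f : A → B, g : B → A with d_B(f x, y) = d_A(x, g y) for all x, y. Then: (i) g is isometric (d_A(g y, g y') = d_B(y, y') for all y, y' ∈ B) if and only if f(g y) = y for all y ∈ B; and (ii) f is isometric (d_B(f x, f x') = d_A(x, x') for all x, x' ∈ A) if and only if g(f x) = x for all x ∈ A. -/
/-- A proximity set (proxet): a set with a proximity map `d : A × A → [0,1]`
that is reflexive, transitive (w.r.t. multiplication) and antisymmetric. -/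
class Proxet (A : Type*) where
  d : A → A → ℝ
  d_nonneg : ∀ x y : A, 0 ≤ d x y
  d_le_one : ∀ x y : A, d x y ≤ 1
  d_refl : ∀ x : A, d x x = 1
  d_trans : ∀ x y z : A, d x y * d y z ≤ d x z
  d_antisymm : ∀ x y : A, d x y = 1 → d y x = 1 → x = y

open Proxet

/-- Residuation on `[0,1]`: `r ⊢ s = 1` if `r ≤ s`, else `s / r`. -/
noncomputable def resid (r s : ℝ) : ℝ := if r ≤ s then 1 else s / r

/-- A lower vector on a proxet `A`: a map `λ : A → [0,1]` with `d(x,y)·λ(y) ≤ λ(x)`. -/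
def IsLowerVector (A : Type*) [Proxet A] (lam : A → ℝ) : Prop :=
  (∀ x : A, 0 ≤ lam x ∧ lam x ≤ 1) ∧ ∀ x y : A, d x y * lam y ≤ lam x

/-- An upper vector on a proxet `A`: a map `υ : A → [0,1]` with `υ(x)·d(x,y) ≤ υ(y)`. -/
def IsUpperVector (A : Type*) [Proxet A] (u : A → ℝ) : Prop :=
  (∀ x : A, 0 ≤ u x ∧ u x ≤ 1) ∧ ∀ x y : A, u x * d x y ≤ u y

/-- A proximity morphism between proxets. -/
def IsProxMorphism {A B : Type*} [Proxet A] [Proxet B] (f : A → B) : Prop :=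
  ∀ x y : A, d x y ≤ d (f x) (f y)

/-- Projectors: in an adjunction `(f, g)`, `g` is isometric iff `f ∘ g = id`,
and `f` is isometric iff `g ∘ f = id`. -/
theorem stmt8 {A B : Type*} [Proxet A] [Proxet B]
    (f : A → B) (g : B → A) (hf : IsProxMorphism f) (hg : IsProxMorphism g)
    (hadj : ∀ (x : A) (y : B), d (f x) y = d x (g y)) :
    ((∀ y y' : B, d (g y) (g y') = d y y') ↔ ∀ y : B, f (g y) = y) ∧
    ((∀ x x' : A, d (f x) (f x') = d x x') ↔ ∀ x : A, g (f x) = x) := by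
  refine ⟨⟨fun h y => ?_, fun h y y' => ?_⟩, ⟨fun h x => ?_, fun h x x' => ?_⟩⟩
  · have key : ∀ y', d (f (g y)) y' = d y y' := fun y' => (hadj _ _).trans (h y y')
    exact d_antisymm _ _ ((key y).trans (d_refl y)) ((key _).symm.trans (d_refl _))
  · rw [← hadj, h]
  · have key : ∀ x', d x' (g (f x)) = d x' x := fun x' => (hadj _ _).symm.trans (h x' x)
    exact d_antisymm _ _ ((key _).symm.trans (d_refl _)) ((key x).trans (d_refl x))
  · rw [hadj, h]
end

section
/- Let A, B be proxets and Φ : A ↬ B a proximity matrix. Then Φ and its dual Φ‡ form a connection: ⨆_{y∈B} Φ(x,y)·Φ‡(y,x') ≤ d_A(x,x') for all x, x' ∈ A, and ⨆_{x∈A} Φ‡(y,x)·Φ(x,y') ≤ d_B(y,y') for all y, y' ∈ B. -/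
open Proxet

/-- A proximity matrix `Φ : A ↬ B`. -/
def IsProxMatrix {A B : Type*} [Proxet A] [Proxet B] (F : A → B → ℝ) : Prop :=
  (∀ (x : A) (y : B), 0 ≤ F x y ∧ F x y ≤ 1) ∧
  ∀ (u x : A) (y v : B), d u x * F x y * d y v ≤ F u v

/-- The dual matrix `Φ‡ : B ↬ A`,
`Φ‡(y,x) = ⨅_{u,v} (Φ(u,v) ⊢ d(u,x)·d(y,v))`. -/
noncomputable def matDual {A B : Type*} [Proxet A] [Proxet B] (F : A → B → ℝ) :
    B → A → ℝ :=
  fun y x => ⨅ p : A × B, resid (F p.1 p.2) (d p.1 x * d y p.2)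

theorem resid_nonneg {r s : ℝ} (hr : 0 ≤ r) (hs : 0 ≤ s) : 0 ≤ resid r s := by
  unfold resid
  split_ifs
  · exact zero_le_one
  · exact div_nonneg hs hr

theorem mul_resid_le {r s : ℝ} (hs : 0 ≤ s) : r * resid r s ≤ s := by
  unfold resid
  split_ifs with h
  · simpa using h
  · exact (mul_div_cancel₀ s (hs.trans_lt (not_le.mp h)).ne').le

theorem mul_matDual_le {A B : Type*} [Proxet A] [Proxet B] {F : A → B → ℝ}
    (hF : ∀ x y, 0 ≤ F x y) (u x : A) (y v : B) :
    F u v * matDual F y x ≤ d u x * d y v := by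
  have hd (p : A × B) : 0 ≤ d p.1 x * d y p.2 := mul_nonneg (d_nonneg _ _) (d_nonneg _ _)
  have hbdd : BddBelow (Set.range fun p : A × B => resid (F p.1 p.2) (d p.1 x * d y p.2)) :=
    ⟨0, Set.forall_mem_range.mpr fun p => resid_nonneg (hF _ _) (hd p)⟩
  exact (mul_le_mul_of_nonneg_left (ciInf_le hbdd (u, v)) (hF u v)).trans
    (mul_resid_le (hd (u, v)))

/-- A matrix and its dual form a connection. -/
theorem stmt10 {A B : Type*} [Proxet A] [Proxet B]
    (F : A → B → ℝ) (hF : IsProxMatrix F) :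
    (∀ x x' : A, (⨆ y : B, F x y * matDual F y x') ≤ d x x') ∧
    (∀ y y' : B, (⨆ x : A, matDual F y x * F x y') ≤ d y y') := by
  have hF₀ (x : A) (y : B) : 0 ≤ F x y := (hF.1 x y).1
  refine ⟨fun x x' => Real.iSup_le (fun y => ?_) (d_nonneg _ _),
    fun y y' => Real.iSup_le (fun x => ?_) (d_nonneg _ _)⟩
  · simpa [d_refl] using mul_matDual_le hF₀ x x' y y
  · simpa [d_refl, mul_comm] using mul_matDual_le hF₀ x x y y'
end

section
/- (Idempotence of the matrix operators) Let A, B be proxets and Φ : A ↬ B a proximity matrix. Then Φ*(Φ_*(Φ*λ)) = Φ*λ for every lower vector λ on A, and Φ_*(Φ*(Φ_*υ)) = Φ_*υ for every upper vector υ on B. Consequently, for every a ∈ A the pair (Φ_*Φ*∇a, Φ*∇a) is a cut of Φ, and for every b ∈ B the pair (Φ_*Δb, Φ*Φ_*Δb) is a cut of Φ. -/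
open Proxet

/-- `(Φ*λ)(b) = ⨅ₓ (λ(x) ⊢ Φ(x,b))`, an upper vector on `B`. -/
noncomputable def matUp {A B : Type*} (F : A → B → ℝ) (lam : A → ℝ) : B → ℝ :=
  fun b => ⨅ x : A, resid (lam x) (F x b)

/-- `(Φ_*υ)(a) = ⨅_y (υ(y) ⊢ Φ(a,y))`, a lower vector on `A`. -/
noncomputable def matLo {A B : Type*} (F : A → B → ℝ) (u : B → ℝ) : A → ℝ :=
  fun a => ⨅ y : B, resid (u y) (F a y)

/-- A cut of the matrix `Φ`: a pair `(α, β)` of a lower vector on `A` and an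
upper vector on `B` with `Φ*α = β` and `Φ_*β = α`. -/
def IsCut {A B : Type*} [Proxet A] [Proxet B] (F : A → B → ℝ)
    (al : A → ℝ) (be : B → ℝ) : Prop :=
  IsLowerVector A al ∧ IsUpperVector B be ∧ matUp F al = be ∧ matLo F be = al

theorem le_resid_iff {r s t : ℝ} (hs : 0 ≤ s) (hr : 0 ≤ r) (ht : t ≤ 1) :
    t ≤ resid r s ↔ t * r ≤ s := by
  unfold resid
  split_ifs with h
  · exact ⟨fun _ => (mul_le_of_le_one_left hr ht).trans h, fun _ => ht⟩
  · exact le_div_iff₀ (hs.trans_lt (not_le.mp h))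

theorem resid_le_one {r s : ℝ} (hr : 0 ≤ r) : resid r s ≤ 1 := by
  unfold resid
  split_ifs with h
  · exact le_rfl
  · exact div_le_one_of_le₀ (not_le.mp h).le hr

section

variable {A B : Type*} {F : A → B → ℝ} {lam mu : A → ℝ}

/-- The operator `Φ_*` is the operator `Φ*` of the transposed matrix. -/
theorem matLo_eq_matUp_flip (F : A → B → ℝ) (u : B → ℝ) :
    matLo F u = matUp (flip F) u := rfl

theorem matUp_nonneg (hF : ∀ x y, 0 ≤ F x y) (hlam : ∀ x, 0 ≤ lam x) (b : B) :
    0 ≤ matUp F lam b :=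
  Real.iInf_nonneg fun x => resid_nonneg (hlam x) (hF x b)

theorem le_matUp_iff [Nonempty A] (hF : ∀ x y, 0 ≤ F x y) (hlam : ∀ x, 0 ≤ lam x)
    {c : ℝ} (hc : c ≤ 1) (b : B) :
    c ≤ matUp F lam b ↔ ∀ x, c * lam x ≤ F x b := by
  have hbdd : BddBelow (Set.range fun x => resid (lam x) (F x b)) :=
    ⟨0, Set.forall_mem_range.2 fun x => resid_nonneg (hlam x) (hF x b)⟩
  exact (le_ciInf_iff hbdd).trans
    (forall_congr' fun x => le_resid_iff (hF x b) (hlam x) hc)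

theorem matUp_of_isEmpty [IsEmpty A] (b : B) : matUp F lam b = 0 :=
  Real.iInf_of_isEmpty _

theorem matUp_le_one (hF : ∀ x y, 0 ≤ F x y) (hlam : ∀ x, 0 ≤ lam x) (b : B) :
    matUp F lam b ≤ 1 := by
  rcases isEmpty_or_nonempty A with hA | ⟨⟨a⟩⟩
  · rw [matUp_of_isEmpty]
    exact zero_le_one
  · have hbdd : BddBelow (Set.range fun x => resid (lam x) (F x b)) :=
      ⟨0, Set.forall_mem_range.2 fun x => resid_nonneg (hlam x) (hF x b)⟩
    exact (ciInf_le hbdd a).trans (resid_le_one (hlam a))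

theorem matUp_mul_le_apply (hF : ∀ x y, 0 ≤ F x y) (hlam : ∀ x, 0 ≤ lam x) (a : A) (b : B) :
    matUp F lam b * lam a ≤ F a b :=
  have : Nonempty A := ⟨a⟩
  (le_matUp_iff hF hlam (matUp_le_one hF hlam b) b).1 le_rfl a

theorem matUp_anti (hF : ∀ x y, 0 ≤ F x y) (hlam : ∀ x, 0 ≤ lam x) (h : ∀ x, lam x ≤ mu x)
    (b : B) : matUp F mu b ≤ matUp F lam b := by
  have hmu : ∀ x, 0 ≤ mu x := fun x => (hlam x).trans (h x)
  cases isEmpty_or_nonempty A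
  · simp only [matUp_of_isEmpty, le_refl]
  · refine (le_matUp_iff hF hlam (matUp_le_one hF hmu b) b).2 fun x => ?_
    exact (mul_le_mul_of_nonneg_left (h x) (matUp_nonneg hF hmu b)).trans
      (matUp_mul_le_apply hF hmu x b)

theorem le_matUp_flip_matUp (hF : ∀ x y, 0 ≤ F x y) (hlam : ∀ x, 0 ≤ lam x)
    (hlam_one : ∀ x, lam x ≤ 1) [Nonempty B] (a : A) :
    lam a ≤ matUp (flip F) (matUp F lam) a :=
  (le_matUp_iff (fun y x => hF x y) (matUp_nonneg hF hlam) (hlam_one a) a).2 fun b =>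
    (mul_comm _ _).trans_le (matUp_mul_le_apply hF hlam a b)

theorem matUp_flip_matUp (hF : ∀ x y, 0 ≤ F x y) (hlam : ∀ x, 0 ≤ lam x)
    (hlam_one : ∀ x, lam x ≤ 1) :
    matUp F (matUp (flip F) (matUp F lam)) = matUp F lam := by
  funext b
  have : Nonempty B := ⟨b⟩
  have hF' : ∀ y x, 0 ≤ flip F y x := fun y x => hF x y
  refine le_antisymm (matUp_anti hF hlam (le_matUp_flip_matUp hF hlam hlam_one) b) ?_
  cases isEmpty_or_nonempty A
  · simp only [matUp_of_isEmpty, le_refl]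
  · exact le_matUp_flip_matUp (F := flip F) hF' (matUp_nonneg hF hlam)
      (matUp_le_one hF hlam) b

theorem matUp_mul_le_matUp (hF : ∀ x y, 0 ≤ F x y) (hlam : ∀ x, 0 ≤ lam x) {b b' : B} {c : ℝ}
    (hc0 : 0 ≤ c) (hc1 : c ≤ 1) (h : ∀ a, F a b * c ≤ F a b') :
    matUp F lam b * c ≤ matUp F lam b' := by
  cases isEmpty_or_nonempty A
  · simp only [matUp_of_isEmpty, zero_mul, le_refl]
  · refine (le_matUp_iff hF hlam
      (mul_le_one₀ (matUp_le_one hF hlam b) hc0 hc1) b').2 fun a => ?_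
    rw [mul_right_comm]
    exact (mul_le_mul_of_nonneg_right (matUp_mul_le_apply hF hlam a b) hc0).trans (h a)

end

section

variable {A B : Type*} [Proxet A] [Proxet B] {F : A → B → ℝ}

theorem IsProxMatrix.isUpperVector_matUp (hF : IsProxMatrix F) {lam : A → ℝ}
    (hlam : ∀ x, 0 ≤ lam x) : IsUpperVector B (matUp F lam) := by
  have hF0 : ∀ x y, 0 ≤ F x y := fun x y => (hF.1 x y).1
  refine ⟨fun b => ⟨matUp_nonneg hF0 hlam b, matUp_le_one hF0 hlam b⟩, fun x y => ?_⟩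
  refine matUp_mul_le_matUp hF0 hlam (d_nonneg x y) (d_le_one x y) fun a => ?_
  simpa only [d_refl, one_mul] using hF.2 a a x y

theorem IsProxMatrix.isLowerVector_matLo (hF : IsProxMatrix F) {u : B → ℝ}
    (hu : ∀ y, 0 ≤ u y) : IsLowerVector A (matLo F u) := by
  have hF0 : ∀ y x, 0 ≤ flip F y x := fun y x => (hF.1 x y).1
  rw [matLo_eq_matUp_flip]
  refine ⟨fun a => ⟨matUp_nonneg hF0 hu a, matUp_le_one hF0 hu a⟩, fun x y => ?_⟩
  rw [mul_comm]
  refine matUp_mul_le_matUp hF0 hu (d_nonneg x y) (d_le_one x y) fun b => ?_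
  simpa only [flip, d_refl, mul_one, one_mul, mul_comm] using hF.2 x y b b

theorem IsProxMatrix.matUp_matLo_matUp (hF : IsProxMatrix F) {lam : A → ℝ}
    (hlam : ∀ x, 0 ≤ lam x ∧ lam x ≤ 1) :
    matUp F (matLo F (matUp F lam)) = matUp F lam :=
  matUp_flip_matUp (fun x y => (hF.1 x y).1) (fun x => (hlam x).1) fun x => (hlam x).2

theorem IsProxMatrix.matLo_matUp_matLo (hF : IsProxMatrix F) {u : B → ℝ}
    (hu : ∀ y, 0 ≤ u y ∧ u y ≤ 1) :
    matLo F (matUp F (matLo F u)) = matLo F u :=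
  matUp_flip_matUp (F := flip F) (fun y x => (hF.1 x y).1) (fun y => (hu y).1)
    fun y => (hu y).2

end

/-- Idempotence of the matrix operators, and the representable cuts. -/
theorem stmt14 {A B : Type*} [Proxet A] [Proxet B]
    (F : A → B → ℝ) (hF : IsProxMatrix F) :
    (∀ lam : A → ℝ, IsLowerVector A lam →
      matUp F (matLo F (matUp F lam)) = matUp F lam) ∧
    (∀ u : B → ℝ, IsUpperVector B u →
      matLo F (matUp F (matLo F u)) = matLo F u) ∧
    (∀ a : A, IsCut F (matLo F (matUp F (fun x => d x a))) (matUp F (fun x => d x a))) ∧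
    (∀ b : B, IsCut F (matLo F (fun y => d b y)) (matUp F (matLo F (fun y => d b y)))) := by
  refine ⟨fun lam hlam => hF.matUp_matLo_matUp hlam.1,
    fun u hu => hF.matLo_matUp_matLo hu.1, fun a => ?_, fun b => ?_⟩
  · have hup := hF.isUpperVector_matUp fun x => d_nonneg x a
    exact ⟨hF.isLowerVector_matLo fun y => (hup.1 y).1, hup,
      hF.matUp_matLo_matUp fun x => ⟨d_nonneg x a, d_le_one x a⟩, rfl⟩
  · have hlo := hF.isLowerVector_matLo fun y => d_nonneg b y
    exact ⟨hlo, hF.isUpperVector_matUp fun x => (hlo.1 x).1, rfl,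
      hF.matLo_matUp_matLo fun y => ⟨d_nonneg b y, d_le_one b y⟩⟩
end

section
/- (Decomposition through representable concepts) Let A, B be proxets and Φ : A ↬ B a proximity matrix. Then for all x ∈ A and y ∈ B: Φ(x,y) = ⨆_{a∈A} (Φ_*Φ*∇a)(x)·(Φ*∇a)(y) and Φ(x,y) = ⨆_{b∈B} (Φ_*Δb)(x)·(Φ*Φ_*Δb)(y); that is, Φ is recovered as the composite of the projection and embedding matrices restricted to the representable concepts of Φ. -/
open Proxet

theorem resid_one_left {s : ℝ} (hs : s ≤ 1) : resid 1 s = s := by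
  unfold resid
  split_ifs with h
  · exact le_antisymm h hs
  · exact div_one s

theorem resid_self (r : ℝ) : resid r r = 1 := if_pos le_rfl

theorem resid_mul_le {r s : ℝ} (hs : 0 ≤ s) : resid r s * r ≤ s := by
  unfold resid
  split_ifs with h
  · simpa using h
  · rw [div_mul_cancel₀ s (hs.trans_lt (not_le.1 h)).ne']

theorem le_resid {r s t : ℝ} (hs : 0 ≤ s) (ht : t ≤ 1) (h : r * t ≤ s) : t ≤ resid r s := by
  unfold resid
  split_ifs with hrs
  · exact ht
  · rwa [le_div_iff₀' (hs.trans_lt (not_le.1 hrs))]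

theorem matUp_le {A B : Type*} {F : A → B → ℝ} {lam : A → ℝ} (hF : ∀ x y, 0 ≤ F x y)
    (hlam : ∀ x, 0 ≤ lam x) (a : A) (b : B) : matUp F lam b ≤ resid (lam a) (F a b) :=
  ciInf_le ⟨0, Set.forall_mem_range.2 fun x => resid_nonneg (hlam x) (hF x b)⟩ a

/-- The Yoneda lemma for vectors: evaluating at a representable vector recovers the row. -/
theorem matUp_representable {A B : Type*} {F : A → B → ℝ} (hF : ∀ x y, 0 ≤ F x y ∧ F x y ≤ 1)
    {lam : A → ℝ} (hlam : ∀ z, 0 ≤ lam z) {a : A} (ha : lam a = 1)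
    (h : ∀ z b, lam z * F a b ≤ F z b) : matUp F lam = F a := by
  funext b
  have : Nonempty A := ⟨a⟩
  refine le_antisymm ?_ (le_ciInf fun z => le_resid (hF z b).1 (hF a b).2 (h z b))
  have := matUp_le (fun x y => (hF x y).1) hlam a b
  rwa [ha, resid_one_left (hF a b).2] at this

theorem iSup_matLo_row_mul {A B : Type*} {F : A → B → ℝ} (hF : ∀ x y, 0 ≤ F x y) (x : A) (y : B) :
    ⨆ a : A, matLo F (F a) x * F a y = F x y := by
  have : Nonempty A := ⟨x⟩
  have : Nonempty B := ⟨y⟩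
  have hle (a : A) : matLo F (F a) x * F a y ≤ F x y :=
    (mul_le_mul_of_nonneg_right
      (matUp_le (F := fun b a => F a b) (fun b a => hF a b) (hF a) y x) (hF a y)).trans
      (resid_mul_le (hF x y))
  refine le_antisymm (ciSup_le hle) ?_
  refine le_ciSup_of_le ⟨F x y, Set.forall_mem_range.2 hle⟩ x ?_
  simp [matLo, resid_self]

/-- Decomposition through the representable concepts:
`Φ(x,y) = ⨆_a (Φ_*Φ*∇a)(x)·(Φ*∇a)(y) = ⨆_b (Φ_*Δb)(x)·(Φ*Φ_*Δb)(y)`. -/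
theorem stmt17 {A B : Type*} [Proxet A] [Proxet B]
    (F : A → B → ℝ) (hF : IsProxMatrix F) (x : A) (y : B) :
    F x y = (⨆ a : A, matLo F (matUp F (fun z => d z a)) x * matUp F (fun z => d z a) y) ∧
    F x y = ⨆ b : B, matLo F (fun w => d b w) x * matUp F (matLo F (fun w => d b w)) y := by
  have hpos (x : A) (y : B) := (hF.1 x y).1
  constructor
  · have hrow (a : A) : matUp F (fun z => d z a) = F a :=
      matUp_representable hF.1 (fun z => d_nonneg z a) (d_refl a) fun z b => by
        simpa [d_refl] using hF.2 z a b b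
    simp only [hrow]
    exact (iSup_matLo_row_mul hpos x y).symm
  · have hcol (b : B) : matLo F (fun w => d b w) = fun a => F a b :=
      matUp_representable (F := fun b a => F a b) (fun b a => hF.1 a b) (fun w => d_nonneg b w)
        (d_refl b) fun w a => by
          simpa [d_refl, mul_comm] using hF.2 a a b w
    simp only [hcol]
    simp_rw [mul_comm (F x _)]
    exact (iSup_matLo_row_mul (F := fun b a => F a b) (fun b a => hpos a b) y x).symm
end

section
/- (Matrices correspond to adjunctions between the vector proxets) Let A, B be proxets. Suppose F maps lower vectors on A to upper vectors on B, and G maps upper vectors on B to lower vectors on A, such that for every lower vector λ on A and upper vector υ on B: ⨅_{y∈B} (υ(y) ⊢ (Fλ)(y)) = ⨅_{x∈A} (λ(x) ⊢ (Gυ)(x)). Define Φ(x,y) := (F∇x)(y). Then Φ is a proximity matrix A ↬ B, and F = Φ* and G = Φ_*, i.e. (Fλ)(b) = ⨅_{x∈A} (λ(x) ⊢ Φ(x,b)) and (Gυ)(a) = ⨅_{y∈B} (υ(y) ⊢ Φ(a,y)) for all λ, υ, a, b. -/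
open Proxet

/-- An infimum of residuals is the value at `a` as soon as the weight at `a` is `1` and that
value is a lower bound. -/
theorem iInf_resid_eq {ι : Type*} {w f : ι → ℝ} (a : ι) (hwa : w a = 1)
    (hf : ∀ x, 0 ≤ f x ∧ f x ≤ 1) (h : ∀ x, w x * f a ≤ f x) :
    ⨅ x, resid (w x) (f x) = f a := by
  have hle : ∀ x, f a ≤ resid (w x) (f x) := fun x =>
    le_resid (hf x).1 (hf a).2 (h x)
  have : Nonempty ι := ⟨a⟩
  apply le_antisymm
  · have hbdd : BddBelow (Set.range fun x => resid (w x) (f x)) :=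
      ⟨f a, by rintro _ ⟨x, rfl⟩; exact hle x⟩
    calc ⨅ x, resid (w x) (f x) ≤ resid (w a) (f a) := ciInf_le hbdd a
      _ = f a := by rw [hwa, resid_one_left (hf a).2]
  · exact le_ciInf hle

theorem isLowerVector_d {A : Type*} [Proxet A] (a : A) : IsLowerVector A (fun z => d z a) :=
  ⟨fun x => ⟨d_nonneg x a, d_le_one x a⟩, fun x y => d_trans x y a⟩

theorem isUpperVector_d {A : Type*} [Proxet A] (a : A) : IsUpperVector A (fun z => d a z) :=
  ⟨fun x => ⟨d_nonneg a x, d_le_one a x⟩, fun x y => d_trans a x y⟩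

theorem IsLowerVector.iInf_resid_d {A : Type*} [Proxet A] {lam : A → ℝ}
    (h : IsLowerVector A lam) (a : A) : ⨅ x, resid (d x a) (lam x) = lam a :=
  iInf_resid_eq a (d_refl a) h.1 fun x => h.2 x a

theorem IsUpperVector.iInf_resid_d {A : Type*} [Proxet A] {u : A → ℝ}
    (h : IsUpperVector A u) (a : A) : ⨅ x, resid (d a x) (u x) = u a :=
  iInf_resid_eq a (d_refl a) h.1 fun x => by
    rw [mul_comm]; exact h.2 a x

/-- Matrices correspond to adjunctions between the vector proxets: an
adjunction `F ⊣ G` between `⇓A` and `⇑B` is induced by the matrix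
`Φ(x,y) = (F∇x)(y)`, with `F = Φ*` and `G = Φ_*`. -/
theorem stmt18 {A B : Type*} [Proxet A] [Proxet B]
    (F : (A → ℝ) → (B → ℝ)) (G : (B → ℝ) → (A → ℝ))
    (hF : ∀ lam : A → ℝ, IsLowerVector A lam → IsUpperVector B (F lam))
    (hG : ∀ u : B → ℝ, IsUpperVector B u → IsLowerVector A (G u))
    (hadj : ∀ (lam : A → ℝ) (u : B → ℝ), IsLowerVector A lam → IsUpperVector B u →
      (⨅ y : B, resid (u y) (F lam y)) = ⨅ x : A, resid (lam x) (G u x)) :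
    IsProxMatrix (fun (x : A) (y : B) => F (fun z => d z x) y) ∧
    (∀ lam : A → ℝ, IsLowerVector A lam →
      F lam = matUp (fun (x : A) (y : B) => F (fun z => d z x) y) lam) ∧
    (∀ u : B → ℝ, IsUpperVector B u →
      G u = matLo (fun (x : A) (y : B) => F (fun z => d z x) y) u) := by
  have hFd : ∀ a : A, IsUpperVector B (F fun z => d z a) := fun a => hF _ (isLowerVector_d a)
  have hlo : ∀ u : B → ℝ, IsUpperVector B u → ∀ a : A,
      G u a = ⨅ y : B, resid (u y) (F (fun z => d z a) y) := fun u hu a => by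
    rw [hadj _ u (isLowerVector_d a) hu, (hG u hu).iInf_resid_d a]
  have hGd : ∀ (a : A) (b : B), G (fun z => d b z) a = F (fun z => d z a) b := fun a b => by
    rw [hlo _ (isUpperVector_d b) a, (hFd a).iInf_resid_d b]
  refine ⟨⟨fun x y => (hFd x).1 y, fun u x y v => ?_⟩, fun lam hlam => ?_, fun u hu => ?_⟩
  · calc d u x * F (fun z => d z x) y * d y v
        = d u x * (F (fun z => d z x) y * d y v) := mul_assoc _ _ _
      _ ≤ d u x * F (fun z => d z x) v :=
          mul_le_mul_of_nonneg_left ((hFd x).2 y v) (d_nonneg u x)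
      _ ≤ F (fun z => d z u) v := by
          rw [← hGd x v, ← hGd u v]
          exact (hG _ (isUpperVector_d v)).2 u x
  · funext b
    rw [← (hF lam hlam).iInf_resid_d b, hadj lam _ hlam (isUpperVector_d b)]
    simp only [hGd, matUp]
  · funext a
    exact hlo u hu a
end
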